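/- arXiv:0803.2601 — 4 statements merged into one kernel-verified Lean document; each statement's English description precedes it below -/
import Mathlib

section
/- Let G be an abelian group and let A, B ⊆ G be finite and nonempty with |A|, |B| ≥ 2. Then either |A +_1 B| + |A +_2 B| ≥ 2|A| + 2|B| − 4, or there exists a coset x + H contained in A +_2 B, where H is a subgroup of G with |H| ≥ 3. -/
open scoped Pointwise

variable {G : Type*} [AddCommGroup G] [DecidableEq G]

/-- `rep A B g` is the number of representations of `g` as `a + b` with `a ∈ A`, `b ∈ B`. -/
def rep (A B : Finset G) (g : G) : ℕ :=
  ((A ×ˢ B).filter (fun p => p.1 + p.2 = g)).card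

/-- `repSum A B i` is the set `A +_i B` of elements having at least `i` representations. -/
def repSum (A B : Finset G) (i : ℕ) : Finset G :=
  (A + B).filter (fun g => i ≤ rep A B g)

theorem rep_eq_card_filter (A B : Finset G) (g : G) :
    rep A B g = (B.filter (fun b => g - b ∈ A)).card := by
  unfold rep
  refine Finset.card_bij' (fun p _ => p.2) (fun b _ => (g - b, b)) ?_ ?_ ?_ ?_
  · rintro ⟨a, b⟩ h
    simp only [Finset.mem_filter, Finset.mem_product] at h ⊢
    obtain ⟨⟨ha, hb⟩, rfl⟩ := h
    exact ⟨hb, by simpa using ha⟩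
  · intro b h
    simp only [Finset.mem_filter, Finset.mem_product] at h ⊢
    exact ⟨⟨h.2, h.1⟩, by abel⟩
  · rintro ⟨a, b⟩ h
    simp only [Finset.mem_filter, Finset.mem_product] at h
    obtain ⟨-, rfl⟩ := h
    simp
  · intro b h
    rfl

theorem mem_repSum_one {A B : Finset G} {g : G} :
    g ∈ repSum A B 1 ↔ ∃ b ∈ B, g - b ∈ A := by
  rw [repSum, Finset.mem_filter, rep_eq_card_filter, Nat.succ_le_iff, Finset.card_pos]
  constructor
  · rintro ⟨-, b, hb⟩
    exact ⟨b, (Finset.mem_filter.1 hb).1, (Finset.mem_filter.1 hb).2⟩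
  · rintro ⟨b, hb, h⟩
    exact ⟨Finset.mem_add.2 ⟨_, h, b, hb, by abel⟩, b, Finset.mem_filter.2 ⟨hb, h⟩⟩

theorem mem_repSum_two {A B : Finset G} {g : G} :
    g ∈ repSum A B 2 ↔ ∃ b ∈ B, ∃ c ∈ B, b ≠ c ∧ g - b ∈ A ∧ g - c ∈ A := by
  rw [repSum, Finset.mem_filter, rep_eq_card_filter, Nat.succ_le_iff, Finset.one_lt_card]
  simp only [Finset.mem_filter]
  constructor
  · rintro ⟨-, b, hb, c, hc, hbc⟩
    exact ⟨b, hb.1, c, hc.1, hbc, hb.2, hc.2⟩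
  · rintro ⟨b, hb, c, hc, hbc, h, h'⟩
    exact ⟨Finset.mem_add.2 ⟨_, h, b, hb, by abel⟩, b, ⟨hb, h⟩, c, ⟨hc, h'⟩, hbc⟩

theorem repSum_two_subset_one (A B : Finset G) : repSum A B 2 ⊆ repSum A B 1 := by
  intro g hg
  obtain ⟨b, hb, -, -, -, h, -⟩ := mem_repSum_two.1 hg
  exact mem_repSum_one.2 ⟨b, hb, h⟩

theorem repSum_subset_of_rep_le {A B A' B' : Finset G} (h : ∀ g, rep A' B' g ≤ rep A B g)
    {i : ℕ} (hi : 1 ≤ i) : repSum A' B' i ⊆ repSum A B i := by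
  intro g hg
  have h1 := (Finset.mem_filter.1 hg).2.trans (h g)
  refine Finset.mem_filter.2 ⟨?_, h1⟩
  have h2 : 0 < rep A B g := by omega
  rw [rep, Finset.card_pos] at h2
  obtain ⟨p, hp⟩ := h2
  simp only [Finset.mem_filter, Finset.mem_product] at hp
  exact Finset.mem_add.2 ⟨p.1, hp.1.1, p.2, hp.1.2, hp.2⟩

/-- The Dyson transform does not increase the number of representations. -/
theorem rep_dyson_le (A B : Finset G) (e : G) (g : G) :
    rep (A ∪ B.image (e + ·)) (B.filter (fun b => e + b ∈ A)) g ≤ rep A B g := by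
  unfold rep
  refine Finset.card_le_card_of_injOn
    (fun p => if p.1 ∈ A then p else (e + p.2, p.1 - e)) ?_ ?_
  · rintro ⟨a, b⟩ h
    simp only [Finset.coe_filter, Finset.mem_product, Finset.mem_union, Finset.mem_image,
      Finset.mem_filter, Set.mem_ofPred_eq] at h ⊢
    obtain ⟨⟨ha, hb, hbA⟩, rfl⟩ := h
    by_cases haA : a ∈ A
    · simp [haA, hb]
    · obtain ⟨c, hc, rfl⟩ := ha.resolve_left haA
      simp only [haA, if_false]
      exact ⟨⟨hbA, by simpa using hc⟩, by abel⟩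
  · rintro ⟨a, b⟩ h ⟨a', b'⟩ h' heq
    simp only [Finset.coe_filter, Finset.mem_product, Finset.mem_union, Finset.mem_image,
      Finset.mem_filter, Set.mem_ofPred_eq] at h h'
    by_cases haA : a ∈ A <;> by_cases haA' : a' ∈ A <;>
      simp only [haA, haA', if_true, if_false, Prod.mk.injEq] at heq
    · exact Prod.ext heq.1 heq.2
    · refine absurd h.1.2.2 ?_
      rw [heq.2]
      simpa using haA'
    · refine absurd h'.1.2.2 ?_
      rw [← heq.2]
      simpa using haA
    · exact Prod.ext (sub_left_injective heq.2) (add_right_injective e heq.1)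

/-- `A +_2 B` contains a coset of a subgroup with at least three elements. -/
def ContainsLargeCoset (A B : Finset G) : Prop :=
  ∃ (x : G) (H : AddSubgroup G), 3 ≤ Nat.card H ∧
    x +ᵥ (H : Set G) ⊆ (repSum A B 2 : Set G)

theorem ContainsLargeCoset.of_shift {A B A' B' : Finset G} (t : G)
    (h : ∀ g ∈ repSum A B 2, t + g ∈ repSum A' B' 2) (hC : ContainsLargeCoset A B) :
    ContainsLargeCoset A' B' := by
  obtain ⟨x, H, hH, hsub⟩ := hC
  refine ⟨t + x, H, hH, ?_⟩
  rintro _ ⟨y, hy, rfl⟩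
  have := h (x + y) (hsub ⟨y, hy, rfl⟩)
  simpa [add_assoc] using this

theorem containsLargeCoset_of_periodic {A B : Finset G} (hA : A.Nonempty) (hB : 3 ≤ B.card)
    (h : ∀ b ∈ B, ∀ c ∈ B, ∀ a ∈ A, a + (b - c) ∈ A) : ContainsLargeCoset A B := by
  obtain ⟨a, ha⟩ := hA
  obtain ⟨b, hb, c, hc, hbc⟩ := Finset.one_lt_card.1 (show 1 < B.card by omega)
  let K : AddSubgroup G := AddSubgroup.closure {x | ∃ b ∈ B, ∃ c ∈ B, x = b - c}
  have hK : ∀ x ∈ K, ∀ a ∈ A, a + x ∈ A ∧ a - x ∈ A := by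
    intro x hx
    induction hx using AddSubgroup.closure_induction with
    | mem x hx =>
      obtain ⟨b, hb, c, hc, rfl⟩ := hx
      intro a ha
      refine ⟨h b hb c hc a ha, ?_⟩
      have := h c hc b hb a ha
      rwa [← neg_sub b c, ← sub_eq_add_neg] at this
    | zero => intro a ha; simpa using ha
    | add x y _ _ hx hy =>
      intro a ha
      rw [← add_assoc, ← sub_sub]
      exact ⟨(hy _ (hx a ha).1).1, (hy _ (hx a ha).2).2⟩
    | neg x _ hx =>
      intro a ha
      rw [← sub_eq_add_neg, sub_neg_eq_add]
      exact ⟨(hx a ha).2, (hx a ha).1⟩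
  have hfin : (K : Set G).Finite := by
    refine Set.Finite.of_finite_image (f := (a + ·)) (A.finite_toSet.subset ?_)
      (add_right_injective a).injOn
    rintro _ ⟨x, hx, rfl⟩
    exact (hK x hx a ha).1
  refine ⟨a + b, K, ?_, ?_⟩
  · have h1 : ((B.image (· - b) : Finset G) : Set G) ⊆ K := by
      intro x hx
      obtain ⟨c, hc, rfl⟩ := Finset.mem_image.1 (Finset.mem_coe.1 hx)
      exact AddSubgroup.subset_closure ⟨c, hc, b, hb, rfl⟩
    have h2 := Set.ncard_le_ncard h1 hfin
    rw [Set.ncard_coe_finset, Finset.card_image_of_injective _ sub_left_injective] at h2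
    exact hB.trans h2
  · rintro _ ⟨x, hx, rfl⟩
    refine mem_repSum_two.2 ⟨b, hb, c, hc, hbc, ?_, ?_⟩
    · simp only [vadd_eq_add]
      rw [add_right_comm, add_sub_cancel_right]
      exact (hK x hx a ha).1
    · have := h b hb c hc _ (hK x hx a ha).1
      convert this using 1
      simp only [vadd_eq_add]
      abel

/-- Every translate of `B` meeting `A` in at least two points is contained in `A`. -/
def TranslateClosed (A B : Finset G) : Prop :=
  ∀ p, ∀ b ∈ B, ∀ c ∈ B, b ≠ c → p + b ∈ A → p + c ∈ A → ∀ d ∈ B, p + d ∈ A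

/-- The set of translations carrying `B` into `A`. -/
def translates (A B : Finset G) : Finset G :=
  (A - B).filter (fun p => ∀ b ∈ B, p + b ∈ A)

theorem mem_translates {A B : Finset G} (hB : B.Nonempty) {p : G} :
    p ∈ translates A B ↔ ∀ b ∈ B, p + b ∈ A := by
  refine ⟨fun h => (Finset.mem_filter.1 h).2, fun h => Finset.mem_filter.2 ⟨?_, h⟩⟩
  obtain ⟨b, hb⟩ := hB
  exact Finset.mem_sub.2 ⟨p + b, h b hb, b, hb, by abel⟩

theorem TranslateClosed.translates_closed {A B : Finset G} (hB : B.Nonempty)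
    (h : TranslateClosed A B) : TranslateClosed (translates A B) B := by
  intro p b hb c hc hbc h1 h2 d hd
  rw [mem_translates hB] at h1 h2 ⊢
  intro f hf
  rw [add_right_comm]
  refine h (p + f) b hb c hc hbc ?_ ?_ d hd
  · rw [add_right_comm]; exact h1 f hf
  · rw [add_right_comm]; exact h2 f hf

/-- Two representations of the same element force a translate of `B` inside `A`. -/
theorem TranslateClosed.sub_mem {A B : Finset G} (hcl : TranslateClosed A B) {a a' b c : G}
    (ha : a ∈ A) (ha' : a' ∈ A) (hb : b ∈ B) (hc : c ∈ B) (hbc : b ≠ c)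
    (heq : a + b = a' + c) : a - c ∈ translates A B := by
  rw [mem_translates ⟨b, hb⟩]
  refine hcl (a - c) c hc b hb hbc.symm (by simpa using ha) ?_
  rwa [show a - c + b = a' by rw [sub_add_eq_add_sub, heq]; abel]

theorem TranslateClosed.erase {A B : Finset G} (hB : B.Nonempty) (hcl : TranslateClosed A B)
    {z : G} (hz : ∀ b ∈ B, z - b ∉ translates A B) : TranslateClosed (A.erase z) B := by
  intro p b hb c hc hbc h1 h2 d hd
  have h3 := hcl p b hb c hc hbc (Finset.mem_of_mem_erase h1) (Finset.mem_of_mem_erase h2)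
  refine Finset.mem_erase.2 ⟨?_, h3 d hd⟩
  rintro rfl
  exact hz d hd (by rw [add_sub_cancel_right, mem_translates hB]; exact h3)

theorem card_repSum_one_erase {A B : Finset G} (hcl : TranslateClosed A B) {z : G} (hzA : z ∈ A)
    (hz : ∀ b ∈ B, z - b ∉ translates A B) :
    (repSum (A.erase z) B 1).card + B.card ≤ (repSum A B 1).card := by
  rw [← Finset.card_image_of_injective B (add_right_injective z), ← Finset.card_union_of_disjoint]
  · refine Finset.card_le_card (Finset.union_subset ?_ ?_)
    · intro g hg
      obtain ⟨b, hb, h⟩ := mem_repSum_one.1 hg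
      exact mem_repSum_one.2 ⟨b, hb, Finset.mem_of_mem_erase h⟩
    · intro g hg
      obtain ⟨b, hb, rfl⟩ := Finset.mem_image.1 hg
      exact mem_repSum_one.2 ⟨b, hb, by simpa using hzA⟩
  · rw [Finset.disjoint_left]
    intro g hg hg'
    obtain ⟨c, hc, h⟩ := mem_repSum_one.1 hg
    obtain ⟨b, hb, rfl⟩ := Finset.mem_image.1 hg'
    have hbc : b ≠ c := by
      rintro rfl
      simp at h
    exact hz c hc (hcl.sub_mem hzA (Finset.mem_of_mem_erase h) hb hc hbc (by abel))

theorem repSum_two_erase_subset (A B : Finset G) (z : G) :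
    repSum (A.erase z) B 2 ⊆ repSum A B 2 := by
  intro g hg
  obtain ⟨b, hb, c, hc, hbc, h, h'⟩ := mem_repSum_two.1 hg
  exact mem_repSum_two.2
    ⟨b, hb, c, hc, hbc, Finset.mem_of_mem_erase h, Finset.mem_of_mem_erase h'⟩

theorem repSum_one_translates {A B : Finset G} (hB : B.Nonempty)
    (hcov : ∀ a ∈ A, ∃ b ∈ B, a - b ∈ translates A B) : repSum (translates A B) B 1 = A := by
  ext a
  rw [mem_repSum_one]
  refine ⟨?_, hcov a⟩
  rintro ⟨b, hb, h⟩
  simpa using (mem_translates hB).1 h b hb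

/-- Elements with a unique representation in `A + B` correspond to elements of `A` with a unique
representation in `translates A B + B`. -/
theorem card_unique_le {A B : Finset G} (hB : B.Nonempty)
    (hcov : ∀ a ∈ A, ∃ b ∈ B, a - b ∈ translates A B) :
    (repSum A B 1 \ repSum A B 2).card ≤ (A \ repSum (translates A B) B 2).card := by
  have key : ∀ s ∈ repSum A B 1 \ repSum A B 2, ∃ b ∈ B, s - b ∈ A ∧
      ∀ c ∈ B, s - b - c ∈ translates A B → c = b := by
    intro s hs
    rw [Finset.mem_sdiff] at hs
    obtain ⟨b, hb, h⟩ := mem_repSum_one.1 hs.1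
    refine ⟨b, hb, h, fun c hc hsc => ?_⟩
    by_contra hcb
    refine hs.2 (mem_repSum_two.2 ⟨c, hc, b, hb, hcb, ?_, h⟩)
    have := (mem_translates hB).1 hsc b hb
    rwa [sub_right_comm, sub_add_cancel] at this
  choose! f hfB hfA hf using key
  refine Finset.card_le_card_of_injOn (fun s => s - f s) ?_ ?_
  · intro s hs
    refine Finset.mem_coe.2 (Finset.mem_sdiff.2 ⟨hfA s hs, fun h => ?_⟩)
    obtain ⟨b, hb, c, hc, hbc, h1, h2⟩ := mem_repSum_two.1 h
    exact hbc ((hf s hs b hb h1).trans (hf s hs c hc h2).symm)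
  · intro s hs s' hs' heq
    simp only at heq
    obtain ⟨b, hb, h1⟩ := hcov _ (hfA s hs)
    have e1 := hf s hs b hb h1
    rw [heq] at h1
    have e2 := hf s' hs' b hb h1
    rw [← e1, ← e2] at heq
    exact sub_left_injective heq

theorem card_growth {A B : Finset G} (hcl : TranslateClosed A B) (hB : 2 ≤ B.card) :
    2 * A.card ≤ (repSum A B 1).card + (translates A B).card := by
  obtain ⟨b, hb, c, hc, hbc⟩ := Finset.one_lt_card.1 hB
  have h1 : (translates A B).image (· + b) ⊆ A := by
    intro x hx
    obtain ⟨e, he, rfl⟩ := Finset.mem_image.1 hx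
    exact (mem_translates ⟨b, hb⟩).1 he b hb
  have h2 := Finset.card_sdiff_add_card_eq_card h1
  rw [Finset.card_image_of_injective _ (add_left_injective b)] at h2
  have h3 : ((A \ (translates A B).image (· + b)).image (· + c) ∪ A.image (· + b)).card ≤
      (repSum A B 1).card := by
    refine Finset.card_le_card (Finset.union_subset ?_ ?_)
    · intro g hg
      obtain ⟨a, ha, rfl⟩ := Finset.mem_image.1 hg
      exact mem_repSum_one.2 ⟨c, hc, by simpa using (Finset.mem_sdiff.1 ha).1⟩
    · intro g hg
      obtain ⟨a, ha, rfl⟩ := Finset.mem_image.1 hg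
      exact mem_repSum_one.2 ⟨b, hb, by simpa using ha⟩
  rw [Finset.card_union_of_disjoint, Finset.card_image_of_injective _ (add_left_injective c),
    Finset.card_image_of_injective _ (add_left_injective b)] at h3
  · omega
  · rw [Finset.disjoint_left]
    intro g hg hg'
    obtain ⟨a, ha, rfl⟩ := Finset.mem_image.1 hg
    obtain ⟨a', ha', heq⟩ := Finset.mem_image.1 hg'
    rw [Finset.mem_sdiff] at ha
    refine ha.2 (Finset.mem_image.2 ⟨a - b, ?_, by simp⟩)
    exact hcl.sub_mem ha.1 ha' hc hb hbc.symm heq.symm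

theorem card_growth_of_translates_eq_singleton {A B : Finset G} (hcl : TranslateClosed A B)
    (hB : 3 ≤ B.card) {e : G} (he : translates A B = {e}) :
    A.card + (2 * B.card - 3) ≤ (repSum A B 1).card := by
  obtain ⟨b, c, d, hb, hc, hd, hbc, hbd, hcd⟩ := Finset.two_lt_card_iff.1 hB
  have heA : ∀ x ∈ B, e + x ∈ A := (mem_translates ⟨b, hb⟩).1 (by simp [he])
  have huniq : ∀ x ∈ B, ∀ y ∈ B, ∀ a ∈ A, ∀ z ∈ B, y ≠ z → e + x + y = a + z → x = z := by
    intro x hx y hy a ha z hz hyz heq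
    have := hcl.sub_mem (heA x hx) ha hy hz hyz heq
    rw [he, Finset.mem_singleton] at this
    simpa [add_sub_assoc, sub_eq_zero] using this
  have h1 : (A.image (· + b) ∪ ((B.erase b).image (e + c + ·) ∪
      ((B.erase b).erase c).image (e + d + ·))).card ≤ (repSum A B 1).card := by
    refine Finset.card_le_card (Finset.union_subset ?_ (Finset.union_subset ?_ ?_))
    · intro g hg
      obtain ⟨a, ha, rfl⟩ := Finset.mem_image.1 hg
      exact mem_repSum_one.2 ⟨b, hb, by simpa using ha⟩
    · intro g hg
      obtain ⟨x, hx, rfl⟩ := Finset.mem_image.1 hg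
      exact mem_repSum_one.2 ⟨x, Finset.mem_of_mem_erase hx, by simpa using heA c hc⟩
    · intro g hg
      obtain ⟨x, hx, rfl⟩ := Finset.mem_image.1 hg
      exact mem_repSum_one.2 ⟨x, Finset.mem_of_mem_erase (Finset.mem_of_mem_erase hx),
        by simpa using heA d hd⟩
  rw [Finset.card_union_of_disjoint, Finset.card_union_of_disjoint,
    Finset.card_image_of_injective _ (add_left_injective b),
    Finset.card_image_of_injective _ (add_right_injective (e + c)),
    Finset.card_image_of_injective _ (add_right_injective (e + d)),
    Finset.card_erase_of_mem (Finset.mem_erase.2 ⟨hbc.symm, hc⟩),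
    Finset.card_erase_of_mem hb] at h1
  · omega
  · rw [Finset.disjoint_left]
    intro g hg hg'
    obtain ⟨x, hx, rfl⟩ := Finset.mem_image.1 hg
    obtain ⟨y, hy, heq⟩ := Finset.mem_image.1 hg'
    simp only [Finset.mem_erase] at hx hy
    have hxy : x ≠ y := by
      rintro rfl
      exact hcd (add_right_injective e (add_left_injective x heq.symm))
    exact hy.1 (huniq c hc x hx.2 _ (heA d hd) y hy.2.2 hxy heq.symm).symm
  · rw [Finset.disjoint_left]
    intro g hg hg'
    obtain ⟨a, ha, rfl⟩ := Finset.mem_image.1 hg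
    rcases Finset.mem_union.1 hg' with h | h <;> obtain ⟨x, hx, heq⟩ := Finset.mem_image.1 h <;>
      simp only [Finset.mem_erase] at hx
    · exact hbc (huniq c hc x hx.2 a ha b hb hx.1 heq).symm
    · exact hbd (huniq d hd x hx.2.2 a ha b hb hx.2.1 heq).symm

theorem bound_of_translateClosed {B : Finset G} (hB : 3 ≤ B.card) (n : ℕ) :
    ∀ A : Finset G, A.card = n → 2 ≤ A.card → TranslateClosed A B →
      2 * A.card + 2 * B.card ≤ (repSum A B 1).card + (repSum A B 2).card + 4 ∨
        ContainsLargeCoset A B := by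
  induction n using Nat.strong_induction_on with
  | _ n ih =>
  rintro A rfl hA hcl
  have hBne : B.Nonempty := Finset.card_pos.1 (by omega)
  by_cases hcov : ∀ a ∈ A, ∃ b ∈ B, a - b ∈ translates A B
  · have hEne : (translates A B).Nonempty := by
      obtain ⟨a, ha⟩ : A.Nonempty := Finset.card_pos.1 (by omega)
      obtain ⟨b, -, h⟩ := hcov a ha
      exact ⟨_, h⟩
    have hS1 := repSum_one_translates hBne hcov
    have hV := card_unique_le hBne hcov
    have hsub : repSum (translates A B) B 2 ⊆ A :=
      (repSum_two_subset_one _ _).trans hS1.subset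
    have hc1 := Finset.card_sdiff_add_card_eq_card hsub
    have hc2 := Finset.card_sdiff_add_card_eq_card (repSum_two_subset_one A B)
    have hshift : ∀ b ∈ B, (translates A B).image (· + b) ⊆ A := by
      intro b hb x hx
      obtain ⟨e, he, rfl⟩ := Finset.mem_image.1 hx
      exact (mem_translates hBne).1 he b hb
    rcases le_or_gt A.card (translates A B).card with hle | hlt
    · right
      refine containsLargeCoset_of_periodic (Finset.card_pos.1 (by omega)) hB ?_
      intro b hb c hc a ha
      have heq : (translates A B).image (· + c) = A :=
        Finset.eq_of_subset_of_card_le (hshift c hc)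
          (by rwa [Finset.card_image_of_injective _ (add_left_injective c)])
      rw [← heq] at ha
      obtain ⟨e, he, rfl⟩ := Finset.mem_image.1 ha
      rw [show e + c + (b - c) = e + b by abel]
      exact (mem_translates hBne).1 he b hb
    · rcases (Nat.succ_le_iff.2 hEne.card_pos).eq_or_lt with h1 | h2
      · obtain ⟨e, he⟩ := Finset.card_eq_one.1 h1.symm
        have hg := card_growth_of_translates_eq_singleton hcl hB he
        have hAB : A.card = B.card := by
          have : A = B.image (e + ·) := by
            ext a
            rw [Finset.mem_image]
            constructor
            · intro ha
              obtain ⟨b, hb, h⟩ := hcov a ha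
              rw [he, Finset.mem_singleton] at h
              exact ⟨b, hb, by rw [← h]; abel⟩
            · rintro ⟨b, hb, rfl⟩
              exact (mem_translates hBne).1 (by simp [he]) b hb
          rw [this, Finset.card_image_of_injective _ (add_right_injective e)]
        left
        omega
      · rcases ih _ hlt _ rfl h2 (hcl.translates_closed hBne) with hbd | hC
        · have hg := card_growth hcl (by omega)
          rw [hS1] at hbd
          left
          omega
        · right
          obtain ⟨b, hb⟩ := hBne
          refine hC.of_shift b fun g hg => ?_
          obtain ⟨c, hc, d, hd, hcd, h, h'⟩ := mem_repSum_two.1 hg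
          refine mem_repSum_two.2 ⟨c, hc, d, hd, hcd, ?_, ?_⟩
          · rw [add_sub_assoc, add_comm]
            exact (mem_translates ⟨b, hb⟩).1 h b hb
          · rw [add_sub_assoc, add_comm]
            exact (mem_translates ⟨b, hb⟩).1 h' b hb
  · push Not at hcov
    obtain ⟨z, hzA, hz⟩ := hcov
    have hcard := card_repSum_one_erase hcl hzA hz
    have hsub := repSum_two_erase_subset A B z
    have hsub' := Finset.card_le_card hsub
    have hez := Finset.card_erase_add_one hzA
    rcases (show 1 ≤ (A.erase z).card by omega).eq_or_lt with h1 | h2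
    · obtain ⟨w, hw⟩ := Finset.card_eq_one.1 h1.symm
      have hBw : B.card ≤ (repSum (A.erase z) B 1).card := by
        rw [← Finset.card_image_of_injective B (add_right_injective w)]
        refine Finset.card_le_card fun g hg => ?_
        obtain ⟨b, hb, rfl⟩ := Finset.mem_image.1 hg
        exact mem_repSum_one.2 ⟨b, hb, by simp [hw]⟩
      left
      omega
    · rcases ih _ (by omega) _ rfl h2 (hcl.erase hBne hz) with hbd | hC
      · left
        omega
      · right
        exact hC.of_shift 0 fun g hg => by simpa using hsub hg

theorem bound_of_card_eq_two (A : Finset G) {B : Finset G} (hB : B.card = 2) :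
    2 * A.card ≤ (repSum A B 1).card + (repSum A B 2).card := by
  obtain ⟨b, c, hbc, rfl⟩ := Finset.card_eq_two.1 hB
  have h := Finset.card_union_add_card_inter (A.image (· + b)) (A.image (· + c))
  rw [Finset.card_image_of_injective _ (add_left_injective b),
    Finset.card_image_of_injective _ (add_left_injective c)] at h
  have h1 : A.image (· + b) ∪ A.image (· + c) ⊆ repSum A {b, c} 1 := by
    refine Finset.union_subset ?_ ?_ <;> intro g hg <;>
      obtain ⟨a, ha, rfl⟩ := Finset.mem_image.1 hg
    · exact mem_repSum_one.2 ⟨b, by simp, by simpa using ha⟩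
    · exact mem_repSum_one.2 ⟨c, by simp, by simpa using ha⟩
  have h2 : A.image (· + b) ∩ A.image (· + c) ⊆ repSum A {b, c} 2 := by
    intro g hg
    rw [Finset.mem_inter] at hg
    obtain ⟨a, ha, rfl⟩ := Finset.mem_image.1 hg.1
    obtain ⟨a', ha', heq⟩ := Finset.mem_image.1 hg.2
    refine mem_repSum_two.2 ⟨b, by simp, c, by simp, hbc, by simpa using ha, ?_⟩
    rw [← heq]
    simpa using ha'
  have := Finset.card_le_card h1
  have := Finset.card_le_card h2
  omega

theorem bound_or_containsLargeCoset (n : ℕ) :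
    ∀ A B : Finset G, B.card = n → 2 ≤ A.card → 2 ≤ B.card →
      2 * A.card + 2 * B.card ≤ (repSum A B 1).card + (repSum A B 2).card + 4 ∨
        ContainsLargeCoset A B := by
  induction n using Nat.strong_induction_on with
  | _ n ih =>
  rintro A B rfl hA hB
  rcases hB.eq_or_lt with h2 | h3
  · left
    have := bound_of_card_eq_two A h2.symm
    omega
  by_cases hcl : TranslateClosed A B
  · exact bound_of_translateClosed h3 _ A rfl hA hcl
  · unfold TranslateClosed at hcl
    push Not at hcl
    obtain ⟨e, b, hb, c, hc, hbc, hbA, hcA, d, hd, hdA⟩ := hcl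
    have hrep := rep_dyson_le A B e
    set A' := A ∪ B.image (e + ·) with hA'
    set B' := B.filter (fun b => e + b ∈ A) with hB'
    have hlt : B'.card < B.card :=
      Finset.card_lt_card (Finset.filter_ssubset.2 ⟨d, hd, hdA⟩)
    have hB'2 : 2 ≤ B'.card := Finset.one_lt_card.2
      ⟨b, Finset.mem_filter.2 ⟨hb, hbA⟩, c, Finset.mem_filter.2 ⟨hc, hcA⟩, hbc⟩
    have hinter : A ∩ B.image (e + ·) = B'.image (e + ·) := by
      ext x
      simp only [hB', Finset.mem_inter, Finset.mem_image, Finset.mem_filter]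
      constructor
      · rintro ⟨hx, y, hy, rfl⟩
        exact ⟨y, ⟨hy, hx⟩, rfl⟩
      · rintro ⟨y, ⟨hy, hx⟩, rfl⟩
        exact ⟨hx, y, hy, rfl⟩
    have hsum := Finset.card_union_add_card_inter A (B.image (e + ·))
    rw [hinter, Finset.card_image_of_injective _ (add_right_injective e),
      Finset.card_image_of_injective _ (add_right_injective e), ← hA'] at hsum
    have hs1 := Finset.card_le_card (repSum_subset_of_rep_le hrep le_rfl)
    have hs2 := repSum_subset_of_rep_le hrep one_le_two
    have hs2' := Finset.card_le_card hs2
    rcases ih _ hlt A' B' rfl (by omega) hB'2 with h | h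
    · left
      omega
    · right
      exact h.of_shift 0 fun g hg => by simpa using hs2 hg

theorem cor_dicks (A B : Finset G) (hA : A.Nonempty) (hB : B.Nonempty)
    (hAt : 2 ≤ A.card) (hBt : 2 ≤ B.card) :
    ((2 * A.card + 2 * B.card - 4 : ℤ) ≤
      ((repSum A B 1).card : ℤ) + ((repSum A B 2).card : ℤ)) ∨
    ∃ (x : G) (H : AddSubgroup G), 3 ≤ Nat.card H ∧
      x +ᵥ (H : Set G) ⊆ (repSum A B 2 : Set G) := by
  rcases bound_or_containsLargeCoset _ A B rfl hAt hBt with h | h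
  · left
    omega
  · exact Or.inr h
end

section
/- Let A and B be finite, nonempty subsets of an abelian group G. If |A + B| = |A| + |B| − 1 and A + B is aperiodic (i.e., its stabilizer is trivial), then for every b ∈ G \ B one has |A + (B ∪ {b})| > |A + B|. -/
open scoped Pointwise

variable {G : Type*} [AddCommGroup G] [DecidableEq G]

/-- the stabilizer `H(S) = {x : G | x + S = S}` of a finite subset `S`. -/
def stab (S : Finset G) : AddSubgroup G := AddAction.stabilizer G S

/-- The stabilizer of a nonempty finite set, as a finite set. -/
def stabFinset (S : Finset G) : Finset G := (S - S).filter fun g => g +ᵥ S = S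

theorem mem_stabFinset {S : Finset G} (hS : S.Nonempty) {g : G} :
    g ∈ stabFinset S ↔ g ∈ AddAction.stabilizer G S := by
  rw [stabFinset, Finset.mem_filter, AddAction.mem_stabilizer_iff, and_iff_right_iff_imp]
  intro h
  obtain ⟨s, hs⟩ := hS
  have hgs : g + s ∈ S := by
    rw [← h]
    exact Finset.vadd_mem_vadd_finset hs
  exact Finset.mem_sub.2 ⟨g + s, hgs, s, hs, add_sub_cancel_right g s⟩

theorem add_mem_iff_of_mem_stabilizer {S : Finset G} {g : G}
    (hg : g ∈ AddAction.stabilizer G S) (c : G) : g + c ∈ S ↔ c ∈ S := by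
  rw [AddAction.mem_stabilizer_iff] at hg
  conv_lhs => rw [← hg]
  exact Finset.vadd_mem_vadd_finset_iff (s := S) g

theorem mem_stabilizer_of_vadd_subset {S : Finset G} {g : G} (h : g +ᵥ S ⊆ S) :
    g ∈ AddAction.stabilizer G S :=
  AddAction.mem_stabilizer_iff.2 (Finset.eq_of_subset_of_card_le h (by simp))

/-- If the sums of elements of `S` and `T`, shifted by `x`, land in `D`, where `S` and `T` lie in
the cosets of `x` modulo `H₁` and `H₂`, then every fibre has at most `|H₁ ∩ H₂|` elements. -/
theorem card_mul_card_le_of_subset_cosets (H₁ H₂ : AddSubgroup G) {K S T D : Finset G} {x : G}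
    (hK : ∀ g ∈ H₁, g ∈ H₂ → g ∈ K) (hS : ∀ z ∈ S, z - x ∈ H₁) (hT : ∀ t ∈ T, t - x ∈ H₂)
    (hD : ∀ z ∈ S, ∀ t ∈ T, z + t - x ∈ D) : S.card * T.card ≤ K.card * D.card := by
  rw [← Finset.card_product]
  refine Finset.card_le_mul_card_image_of_maps_to (f := fun p : G × G => p.1 + p.2 - x)
    (fun p hp => hD _ (Finset.mem_product.1 hp).1 _ (Finset.mem_product.1 hp).2) _ ?_
  intro d _
  rcases ((S ×ˢ T).filter fun p : G × G => p.1 + p.2 - x = d).eq_empty_or_nonempty with h | ⟨q, hq⟩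
  · simp [h]
  · simp only [Finset.mem_filter, Finset.mem_product] at hq
    refine Finset.card_le_card_of_injOn (fun p => p.1 - q.1) ?_ ?_
    · intro p hp
      simp only [Finset.coe_filter, Finset.mem_product, Set.mem_ofPred_eq] at hp
      refine hK _ ?_ ?_
      · simpa using H₁.sub_mem (hS _ hp.1.1) (hS _ hq.1.1)
      · have h := H₂.sub_mem (hT _ hq.1.2) (hT _ hp.1.2)
        have e : q.2 - x - (p.2 - x) = p.1 - q.1 := by
          have := hp.2.trans hq.2.symm
          rw [sub_left_inj] at this
          rw [sub_sub_sub_cancel_right, sub_eq_sub_iff_add_eq_add, add_comm, ← this]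
        rwa [e] at h
    · intro p hp p' hp' h
      simp only [Finset.coe_filter, Finset.mem_product, Set.mem_ofPred_eq] at hp hp'
      have h1 : p.1 = p'.1 := sub_left_injective h
      have h2 := hp.2.trans hp'.2.symm
      rw [sub_left_inj, h1, add_right_inj] at h2
      exact Prod.ext h1 h2

omit [DecidableEq G] in
theorem card_le_card_of_add_mem {K S : Finset G} {x : G} (h : ∀ g ∈ K, g + x ∈ S) :
    K.card ≤ S.card :=
  Finset.card_le_card_of_injOn (fun g => g + x) h fun _ _ _ _ e => add_left_injective x e

theorem stabFinset_card_le_of_mem_sdiff {C₁ C₂ : Finset G} (hC₁ : C₁.Nonempty) {x : G}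
    (hx : x ∈ C₂ \ C₁) :
    (stabFinset C₁).card ≤ (C₂ \ C₁).card + (stabFinset C₁ ∩ stabFinset C₂).card ∨
    (stabFinset C₂).card ≤ (C₁ \ C₂).card + (stabFinset C₁ ∩ stabFinset C₂).card ∨
    (stabFinset C₂).card ≤ (C₂ \ C₁).card := by
  obtain ⟨hx2, hx1⟩ := Finset.mem_sdiff.1 hx
  have hC₂ : C₂.Nonempty := ⟨x, hx2⟩
  set H₁ := AddAction.stabilizer G C₁
  set H₂ := AddAction.stabilizer G C₂
  set K := stabFinset C₁ ∩ stabFinset C₂ with hKdef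
  have hK : ∀ g, g ∈ K ↔ g ∈ H₁ ∧ g ∈ H₂ := fun g => by
    rw [hKdef, Finset.mem_inter, mem_stabFinset hC₁, mem_stabFinset hC₂]
  have hK' : ∀ g ∈ H₁, g ∈ H₂ → g ∈ K := fun g h h' => (hK g).2 ⟨h, h'⟩
  set X₁ := x +ᵥ stabFinset C₁
  set X₂ := x +ᵥ stabFinset C₂
  have hX₁ : ∀ z, z ∈ X₁ ↔ z - x ∈ H₁ := fun z => by
    rw [← mem_stabFinset hC₁, ← Finset.neg_vadd_mem_iff, vadd_eq_add, neg_add_eq_sub]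
  have hX₂ : ∀ z, z ∈ X₂ ↔ z - x ∈ H₂ := fun z => by
    rw [← mem_stabFinset hC₂, ← Finset.neg_vadd_mem_iff, vadd_eq_add, neg_add_eq_sub]
  have hc₁ : X₁.card = (stabFinset C₁).card := Finset.card_vadd_finset _ _
  have hc₂ : X₂.card = (stabFinset C₂).card := Finset.card_vadd_finset _ _
  have hrs := Finset.card_inter_add_card_sdiff X₁ C₂
  have hpq := Finset.card_inter_add_card_sdiff X₂ C₁
  have shift₁ : ∀ z ∈ X₁, ∀ t, z + t - x ∈ C₁ ↔ t ∈ C₁ := fun z hz t => by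
    rw [← add_mem_iff_of_mem_stabilizer ((hX₁ z).1 hz) t, sub_add_eq_add_sub]
  have shift₂ : ∀ t ∈ X₂, ∀ z, z + t - x ∈ C₂ ↔ z ∈ C₂ := fun t ht z => by
    rw [← add_mem_iff_of_mem_stabilizer ((hX₂ t).1 ht) z, sub_add_eq_add_sub, add_comm]
  have hrq : (X₁ ∩ C₂).card * (X₂ \ C₁).card ≤ K.card * (C₂ \ C₁).card := by
    refine card_mul_card_le_of_subset_cosets H₁ H₂ (x := x) hK' ?_ ?_ ?_
    · exact fun z hz => (hX₁ z).1 (Finset.mem_inter.1 hz).1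
    · exact fun z hz => (hX₂ z).1 (Finset.mem_sdiff.1 hz).1
    · intro z hz t ht
      rw [Finset.mem_inter] at hz
      rw [Finset.mem_sdiff] at ht
      rw [Finset.mem_sdiff, shift₁ z hz.1, shift₂ t ht.1]
      exact ⟨hz.2, ht.2⟩
  have hsp : (X₁ \ C₂).card * (X₂ ∩ C₁).card ≤ K.card * (C₁ \ C₂).card := by
    refine card_mul_card_le_of_subset_cosets H₁ H₂ (x := x) hK' ?_ ?_ ?_
    · exact fun z hz => (hX₁ z).1 (Finset.mem_sdiff.1 hz).1
    · exact fun z hz => (hX₂ z).1 (Finset.mem_inter.1 hz).1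
    · intro z hz t ht
      rw [Finset.mem_sdiff] at hz
      rw [Finset.mem_inter] at ht
      rw [Finset.mem_sdiff, shift₁ z hz.1, shift₂ t ht.1]
      exact ⟨ht.2, hz.2⟩
  have hKX₁ : ∀ g ∈ K, ∀ z ∈ X₁, g + z ∈ X₁ := fun g hg z hz => by
    rw [hX₁, add_sub_assoc]
    exact H₁.add_mem ((hK g).1 hg).1 ((hX₁ z).1 hz)
  have hKX₂ : ∀ g ∈ K, ∀ z ∈ X₂, g + z ∈ X₂ := fun g hg z hz => by
    rw [hX₂, add_sub_assoc]
    exact H₂.add_mem ((hK g).1 hg).2 ((hX₂ z).1 hz)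
  have hKC₁ : ∀ g ∈ K, ∀ z, g + z ∈ C₁ ↔ z ∈ C₁ := fun g hg =>
    add_mem_iff_of_mem_stabilizer ((hK g).1 hg).1
  have hKC₂ : ∀ g ∈ K, ∀ z, g + z ∈ C₂ ↔ z ∈ C₂ := fun g hg =>
    add_mem_iff_of_mem_stabilizer ((hK g).1 hg).2
  have hxX₁ : x ∈ X₁ := by simp [hX₁, H₁.zero_mem]
  have hxX₂ : x ∈ X₂ := by simp [hX₂, H₂.zero_mem]
  have hr : K.card ≤ (X₁ ∩ C₂).card := card_le_card_of_add_mem (x := x) fun g hg =>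
    Finset.mem_inter.2 ⟨hKX₁ g hg x hxX₁, (hKC₂ g hg x).2 hx2⟩
  have hq : K.card ≤ (X₂ \ C₁).card := card_le_card_of_add_mem (x := x) fun g hg =>
    Finset.mem_sdiff.2 ⟨hKX₂ g hg x hxX₂, fun h => hx1 ((hKC₁ g hg x).1 h)⟩
  have hKpos : 0 < K.card := Finset.card_pos.2 ⟨0, hK' 0 H₁.zero_mem H₂.zero_mem⟩
  rcases (X₂ ∩ C₁).eq_empty_or_nonempty with hp0 | ⟨p, hp⟩
  · right; right
    rw [hp0, Finset.card_empty, zero_add] at hpq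
    rw [← hc₂, ← hpq]
    exact Nat.le_of_mul_le_mul_left ((Nat.mul_le_mul_right _ hr).trans hrq) hKpos
  rcases (X₁ \ C₂).eq_empty_or_nonempty with hs0 | ⟨s, hs⟩
  · left
    rw [hs0, Finset.card_empty, add_zero] at hrs
    rw [← hc₁, ← hrs]
    refine le_trans ?_ (Nat.le_add_right _ K.card)
    refine Nat.le_of_mul_le_mul_left ?_ hKpos
    rw [mul_comm]
    exact (Nat.mul_le_mul_left _ hq).trans hrq
  have hp' : K.card ≤ (X₂ ∩ C₁).card := card_le_card_of_add_mem (x := p) fun g hg =>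
    Finset.mem_inter.2 ⟨hKX₂ g hg p (Finset.mem_inter.1 hp).1,
      (hKC₁ g hg p).2 (Finset.mem_inter.1 hp).2⟩
  rw [← hc₁, ← hc₂, ← hrs, ← hpq]
  by_contra! hcon
  obtain ⟨h1, h2, -⟩ := hcon
  generalize (X₁ ∩ C₂).card = r at *
  generalize (X₁ \ C₂).card = s at *
  generalize (X₂ ∩ C₁).card = p at *
  generalize (X₂ \ C₁).card = q at *
  generalize (C₂ \ C₁).card = d₂ at *
  generalize (C₁ \ C₂).card = d₁ at *
  generalize K.card = k at *
  have h1' : k * (d₂ + k) < k * (r + s) := Nat.mul_lt_mul_of_pos_left h1 hKpos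
  have h2' : k * (d₁ + k) < k * (p + q) := Nat.mul_lt_mul_of_pos_left h2 hKpos
  have hs' : k ≤ s := by
    by_contra! hlt
    nlinarith [Nat.mul_le_mul hr hq]
  obtain ⟨r, rfl⟩ := Nat.exists_eq_add_of_le hr
  obtain ⟨q, rfl⟩ := Nat.exists_eq_add_of_le hq
  obtain ⟨p, rfl⟩ := Nat.exists_eq_add_of_le hp'
  obtain ⟨s, rfl⟩ := Nat.exists_eq_add_of_le hs'
  nlinarith [Nat.zero_le (r * q), Nat.zero_le (p * s)]

/-- Kneser's lemma on unions of two sets. -/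
theorem le_card_union_add_card_stabFinset {C₁ C₂ : Finset G} {n : ℕ} (hC₁ : C₁.Nonempty)
    (hC₂ : C₂.Nonempty) (h₁ : n ≤ C₁.card + (stabFinset C₁).card)
    (h₂ : n ≤ C₂.card + (stabFinset C₂).card) :
    n ≤ (C₁ ∪ C₂).card + (stabFinset (C₁ ∪ C₂)).card := by
  rcases (C₂ \ C₁).eq_empty_or_nonempty with h | ⟨x, hx⟩
  · rwa [Finset.union_eq_left.2 (Finset.sdiff_eq_empty_iff_subset.1 h)]
  rcases (C₁ \ C₂).eq_empty_or_nonempty with h | ⟨y, hy⟩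
  · rwa [Finset.union_eq_right.2 (Finset.sdiff_eq_empty_iff_subset.1 h)]
  have hK : (stabFinset C₁ ∩ stabFinset C₂).card ≤ (stabFinset (C₁ ∪ C₂)).card := by
    refine Finset.card_le_card fun g hg => ?_
    rw [Finset.mem_inter, mem_stabFinset hC₁, mem_stabFinset hC₂] at hg
    rw [mem_stabFinset (hC₁.mono Finset.subset_union_left), AddAction.mem_stabilizer_iff,
      Finset.vadd_finset_union, hg.1, hg.2]
  have hx' := stabFinset_card_le_of_mem_sdiff hC₁ hx
  have hy' := stabFinset_card_le_of_mem_sdiff hC₂ hy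
  rw [Finset.inter_comm (stabFinset C₂)] at hy'
  have e₁ := Finset.card_sdiff_add_card C₂ C₁
  have e₂ := Finset.card_sdiff_add_card C₁ C₂
  rw [Finset.union_comm] at e₁
  omega

theorem exists_subset_add_le_card_add_card_stabFinset (n : ℕ) : ∀ (A B : Finset G) (a b : G),
    B.card = n → a ∈ A → b ∈ B →
    ∃ C ⊆ A + B, a + b ∈ C ∧ A.card + B.card ≤ C.card + (stabFinset C).card := by
  induction n using Nat.strong_induction_on with
  | _ n ih =>
  intro A B a b hn ha hb
  by_cases hall : ∀ e ∈ A, (e - b) +ᵥ B ⊆ A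
  · have hne : (b +ᵥ A).Nonempty := ⟨b +ᵥ a, Finset.vadd_mem_vadd_finset ha⟩
    refine ⟨b +ᵥ A, ?_, ?_, ?_⟩
    · intro z hz
      obtain ⟨y, hy, rfl⟩ := Finset.mem_vadd_finset.1 hz
      exact Finset.mem_add.2 ⟨y, hy, b, hb, add_comm _ _⟩
    · rw [add_comm]
      exact Finset.vadd_mem_vadd_finset ha
    · rw [Finset.card_vadd_finset]
      refine Nat.add_le_add_left (card_le_card_of_add_mem (x := -b) fun β hβ => ?_) _
      rw [mem_stabFinset hne]
      refine mem_stabilizer_of_vadd_subset fun z hz => ?_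
      obtain ⟨w, hw, rfl⟩ := Finset.mem_vadd_finset.1 hz
      obtain ⟨e, he, rfl⟩ := Finset.mem_vadd_finset.1 hw
      refine Finset.mem_vadd_finset.2 ⟨(e - b) + β,
        hall e he (Finset.vadd_mem_vadd_finset hβ), ?_⟩
      simp only [vadd_eq_add]
      abel
  · push Not at hall
    obtain ⟨e, he, hsub⟩ := hall
    set t := e - b
    have hB' : B ∩ (-t +ᵥ A) ⊂ B := by
      refine Finset.inter_subset_left.ssubset_of_ne fun h => hsub fun z hz => ?_
      obtain ⟨β, hβ, rfl⟩ := Finset.mem_vadd_finset.1 hz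
      rw [← h, Finset.mem_inter, Finset.mem_neg_vadd_finset_iff] at hβ
      exact hβ.2
    have hcard : (A ∪ (t +ᵥ B)).card + (B ∩ (-t +ᵥ A)).card = A.card + B.card := by
      have h1 : (B ∩ (-t +ᵥ A)).card = (A ∩ (t +ᵥ B)).card := by
        rw [← Finset.card_vadd_finset t, Finset.vadd_finset_inter, vadd_neg_vadd,
          Finset.inter_comm]
      rw [h1, Finset.card_union_add_card_inter, Finset.card_vadd_finset]
    obtain ⟨C, hC, habC, hle⟩ := ih _ (hn ▸ Finset.card_lt_card hB') (A ∪ (t +ᵥ B))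
      (B ∩ (-t +ᵥ A)) a b rfl (Finset.mem_union_left _ ha) (Finset.mem_inter.2 ⟨hb, by
        rw [Finset.mem_neg_vadd_finset_iff, vadd_eq_add, sub_add_cancel]
        exact he⟩)
    refine ⟨C, hC.trans fun z hz => ?_, habC, hcard ▸ hle⟩
    obtain ⟨u, hu, v, hv, rfl⟩ := Finset.mem_add.1 hz
    rw [Finset.mem_inter, Finset.mem_neg_vadd_finset_iff] at hv
    rcases Finset.mem_union.1 hu with hu | hu
    · exact Finset.add_mem_add hu hv.1
    · obtain ⟨β, hβ, rfl⟩ := Finset.mem_vadd_finset.1 hu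
      refine Finset.mem_add.2 ⟨t +ᵥ v, hv.2, β, hβ, ?_⟩
      simp only [vadd_eq_add]
      abel

/-- **Kneser's theorem**. -/
theorem card_add_card_le_card_add_add_card_stabFinset {A B : Finset G} (hA : A.Nonempty)
    (hB : B.Nonempty) : A.card + B.card ≤ (A + B).card + (stabFinset (A + B)).card := by
  let P : Finset (Finset G) := (A + B).powerset.filter fun C =>
    C.Nonempty ∧ A.card + B.card ≤ C.card + (stabFinset C).card
  have hP : ∀ c ∈ A + B, ∃ C ∈ P, c ∈ C := fun c hc => by
    obtain ⟨a, ha, b, hb, rfl⟩ := Finset.mem_add.1 hc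
    obtain ⟨C, hC, hab, hle⟩ :=
      exists_subset_add_le_card_add_card_stabFinset _ A B a b rfl ha hb
    exact ⟨C, Finset.mem_filter.2 ⟨Finset.mem_powerset.2 hC, ⟨_, hab⟩, hle⟩, hab⟩
  obtain ⟨c, hc⟩ := hA.add hB
  obtain ⟨C₀, hC₀, -⟩ := hP c hc
  obtain ⟨C, hC, hmax⟩ := P.exists_max_image Finset.card ⟨C₀, hC₀⟩
  obtain ⟨hCsub, hCne, hCle⟩ := Finset.mem_filter.1 hC
  rw [Finset.mem_powerset] at hCsub
  suffices h : A + B ⊆ C by rwa [← hCsub.antisymm h]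
  intro d hd
  obtain ⟨D, hD, hdD⟩ := hP d hd
  obtain ⟨hDsub, hDne, hDle⟩ := Finset.mem_filter.1 hD
  rw [Finset.mem_powerset] at hDsub
  have hU : C ∪ D ∈ P := Finset.mem_filter.2
    ⟨Finset.mem_powerset.2 (Finset.union_subset hCsub hDsub),
      hCne.mono Finset.subset_union_left,
      le_card_union_add_card_stabFinset hCne hDne hCle hDle⟩
  rw [Finset.eq_of_subset_of_card_le Finset.subset_union_left (hmax _ hU)]
  exact Finset.mem_union_right _ hdD

theorem lemma_for_critical_pair (A B : Finset G) (hA : A.Nonempty) (hB : B.Nonempty)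
    (hcard : (A + B).card = A.card + B.card - 1)
    (haper : stab (A + B) = ⊥) :
    ∀ b : G, b ∉ B → (A + B).card < (A + insert b B).card := by
  intro b hb
  by_contra! hle
  have heq : A + B = A + insert b B :=
    Finset.eq_of_subset_of_card_le (Finset.add_subset_add_left (Finset.subset_insert b B)) hle
  have hK := card_add_card_le_card_add_add_card_stabFinset hA (Finset.insert_nonempty b B)
  rw [← heq, Finset.card_insert_of_notMem hb] at hK
  have hstab : (stabFinset (A + B)).card ≤ 1 := by
    refine Finset.card_le_one_iff_subset_singleton.2 ⟨0, fun g hg => ?_⟩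
    rw [mem_stabFinset (hA.add hB), ← stab, haper, AddSubgroup.mem_bot] at hg
    exact Finset.mem_singleton.2 hg
  have := hA.card_pos
  omega
end

section
/- Let G be an abelian group, let A, B ⊆ G be finite and nonempty, let H be the stabilizer of A + B, and let ρ = |A + H| − |A| + |B + H| − |B| be the number of H-holes in A and B. Then |A + B| ≥ |A| + |B| − |H| + ρ. Moreover, if |A + B| ≤ |A| + |B| − 1, then equality holds: |A + B| = |A + H| + |B + H| − |H| = |A| + |B| − |H| + ρ. -/
open scoped Pointwise

variable {G : Type*} [AddCommGroup G] [DecidableEq G]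

theorem mem_stab {S : Finset G} {g : G} : g ∈ stab S ↔ ∀ x ∈ S, g + x ∈ S := by
  rw [stab, AddAction.mem_stabilizer_iff]
  constructor
  · intro h x hx
    rw [← h]
    exact Finset.vadd_mem_vadd_finset hx
  · intro h
    refine Finset.eq_of_subset_of_card_le (fun y hy ↦ ?_) (Finset.card_vadd_finset g S).ge
    obtain ⟨x, hx, rfl⟩ := Finset.mem_vadd_finset.1 hy
    exact h x hx

theorem finite_stab {S : Finset G} (hS : S.Nonempty) : Finite (stab S) := by
  obtain ⟨s, hs⟩ := hS
  refine Finite.of_injective (fun g : stab S ↦ (⟨g + s, mem_stab.1 g.2 s hs⟩ : S)) ?_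
  intro g g' h
  exact Subtype.ext (add_right_cancel (congrArg Subtype.val h))

theorem stab_vadd (b : G) (S : Finset G) : stab (b +ᵥ S) = stab S := by
  ext g
  rw [stab, stab, AddAction.mem_stabilizer_iff, AddAction.mem_stabilizer_iff, vadd_comm,
    vadd_left_cancel_iff]

/-- In the sum map on subsets of two subgroups, each fiber injects into the intersection. -/
theorem card_mul_card_le_of_add_mem {H₁ H₂ : AddSubgroup G} [Finite H₁] {S T U : Finset G}
    (hS : ∀ g ∈ S, g ∈ H₁) (hT : ∀ g ∈ T, g ∈ H₂) (x : G)
    (hU : ∀ s ∈ S, ∀ t ∈ T, s + t + x ∈ U) :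
    S.card * T.card ≤ Nat.card ↥(H₁ ⊓ H₂) * U.card := by
  have : Finite ↥(H₁ ⊓ H₂) := Finite.Set.finite_inter_of_left (H₁ : Set G) H₂
  rw [← Finset.card_product]
  refine Finset.card_le_mul_card_image_of_maps_to (f := fun p : G × G ↦ p.1 + p.2 + x) ?_ _ ?_
  · rintro ⟨s, t⟩ h
    rw [Finset.mem_product] at h
    exact hU s h.1 t h.2
  · intro u _
    obtain h | ⟨⟨s, t⟩, hst⟩ :=
      ((S ×ˢ T).filter fun p : G × G ↦ p.1 + p.2 + x = u).eq_empty_or_nonempty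
    · simp [h]
    · rw [← Nat.card_eq_finsetCard]
      simp only [Finset.mem_filter, Finset.mem_product] at hst
      refine Nat.card_le_card_of_injective (fun p ↦ (⟨p.1.1 - s, ?_⟩ : ↥(H₁ ⊓ H₂))) ?_
      · obtain ⟨⟨s', t'⟩, hp⟩ := p
        simp only [Finset.mem_filter, Finset.mem_product] at hp
        refine ⟨H₁.sub_mem (hS _ hp.1.1) (hS _ hst.1.1), ?_⟩
        have h : s' - s = t - t' := by
          have := add_right_cancel (hp.2.trans hst.2.symm)
          rw [sub_eq_sub_iff_add_eq_add, this, add_comm]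
        simp only [h]
        exact H₂.sub_mem (hT _ hst.1.2) (hT _ hp.1.2)
      · rintro ⟨⟨s₁, t₁⟩, h₁⟩ ⟨⟨s₂, t₂⟩, h₂⟩ h
        simp only [Finset.mem_filter, Finset.mem_product] at h₁ h₂
        have hs : s₁ = s₂ := by simpa using h
        subst hs
        have := add_left_cancel (add_right_cancel (h₁.2.trans h₂.2.symm))
        simp [this]

theorem card_le_of_grid {h m₁ m₂ p q s t b u : ℕ} (hh : 0 < h) (hm₁ : s + b = m₁)
    (hm₂ : t + u = m₂) (hs : h ≤ s) (ht : h ≤ t) (hb : b = 0 ∨ h ≤ b) (hu : u = 0 ∨ h ≤ u)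
    (hp : s * t ≤ h * p) (hq : b * u ≤ h * q) : m₁ ≤ p + h ∨ m₂ ≤ q + h ∨ m₂ ≤ p := by
  subst hm₁ hm₂
  rcases hb with rfl | hb
  · left
    have : h * s ≤ h * p := by nlinarith
    have := Nat.le_of_mul_le_mul_left this hh
    omega
  rcases hu with rfl | hu
  · right; right
    have : h * t ≤ h * p := by nlinarith
    simpa using Nat.le_of_mul_le_mul_left this hh
  by_contra! hcon
  obtain ⟨h₁, h₂, -⟩ := hcon
  have k₁ := Nat.mul_lt_mul_of_pos_left h₁ hh
  have k₂ := Nat.mul_lt_mul_of_pos_left h₂ hh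
  zify at *
  have e₁ : 0 ≤ (s - h : ℤ) * (t - h) := mul_nonneg (by linarith) (by linarith)
  have e₂ : 0 ≤ (b - h : ℤ) * (u - h) := mul_nonneg (by linarith) (by linarith)
  nlinarith

theorem card_stab_le_of_mem_sdiff {C₁ C₂ : Finset G} (hC₁ : C₁.Nonempty) {x : G}
    (hx : x ∈ C₂ \ C₁) :
    Nat.card (stab C₁) ≤ (C₂ \ C₁).card + Nat.card ↥(stab C₁ ⊓ stab C₂) ∨
      Nat.card (stab C₂) ≤ (C₁ \ C₂).card + Nat.card ↥(stab C₁ ⊓ stab C₂) ∨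
      Nat.card (stab C₂) ≤ (C₂ \ C₁).card := by
  obtain ⟨hx₂, hx₁⟩ := Finset.mem_sdiff.1 hx
  have := finite_stab hC₁
  have := finite_stab ⟨x, hx₂⟩
  set H₁ := stab C₁
  set H₂ := stab C₂
  have : Finite ↥(H₁ ⊓ H₂) := Finite.Set.finite_inter_of_left (H₁ : Set G) H₂
  have mem₁ {g y : G} (hg : g ∈ H₁) : g + y ∈ C₁ ↔ y ∈ C₁ :=
    ⟨fun h ↦ by simpa using mem_stab.1 (neg_mem hg) _ h, mem_stab.1 hg y⟩
  have mem₂ {g y : G} (hg : g ∈ H₂) : g + y ∈ C₂ ↔ y ∈ C₂ :=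
    ⟨fun h ↦ by simpa using mem_stab.1 (neg_mem hg) _ h, mem_stab.1 hg y⟩
  let F₁ : Finset G := (Set.toFinite (H₁ : Set G)).toFinset
  let F₂ : Finset G := (Set.toFinite (H₂ : Set G)).toFinset
  have hF₁ : F₁.card = Nat.card H₁ := (Nat.card_eq_card_finite_toFinset _).symm
  have hF₂ : F₂.card = Nat.card H₂ := (Nat.card_eq_card_finite_toFinset _).symm
  have mF₁ {g : G} : g ∈ F₁ ↔ g ∈ H₁ := by simp [F₁]
  have mF₂ {g : G} : g ∈ F₂ ↔ g ∈ H₂ := by simp [F₂]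
  have card_le {X : Finset G} {g : G} (hX : ∀ k ∈ H₁ ⊓ H₂, k + g ∈ X) :
      Nat.card ↥(H₁ ⊓ H₂) ≤ X.card := by
    rw [← Nat.card_eq_finsetCard]
    refine Nat.card_le_card_of_injective (fun k ↦ (⟨k.1 + g, hX k.1 k.2⟩ : X)) ?_
    intro k k' h
    exact Subtype.ext (add_right_cancel (congrArg Subtype.val h))
  have card_le' {X : Finset G} (hX : ∀ g ∈ X, ∀ k ∈ H₁ ⊓ H₂, k + g ∈ X) :
      X.card = 0 ∨ Nat.card ↥(H₁ ⊓ H₂) ≤ X.card := by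
    obtain rfl | ⟨g, hg⟩ := X.eq_empty_or_nonempty
    · simp
    · exact .inr (card_le (hX g hg))
  refine card_le_of_grid Nat.card_pos
    ((Finset.card_filter_add_card_filter_not (s := F₁) (fun g ↦ g + x ∈ C₂)).trans hF₁)
    ((Finset.card_filter_add_card_filter_not (s := F₂) (fun g ↦ g + x ∉ C₁)).trans hF₂)
    (card_le (g := 0) ?_) (card_le (g := 0) ?_) (card_le' ?_) (card_le' ?_)
    (card_mul_card_le_of_add_mem (H₁ := H₁) (H₂ := H₂) ?_ ?_ x ?_)
    (card_mul_card_le_of_add_mem (H₁ := H₁) (H₂ := H₂) ?_ ?_ x ?_)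
  · intro k hk
    simpa [mF₁, mem₂ hk.2, hx₂] using hk.1
  · intro k hk
    simpa [mF₂, mem₁ hk.1, hx₁] using hk.2
  · intro g hg k hk
    simp only [Finset.mem_filter, mF₁] at hg ⊢
    rw [add_assoc, mem₂ hk.2]
    exact ⟨add_mem hk.1 hg.1, hg.2⟩
  · intro g hg k hk
    simp only [Finset.mem_filter, mF₂] at hg ⊢
    rw [add_assoc, mem₁ hk.1]
    exact ⟨add_mem hk.2 hg.1, hg.2⟩
  · intro g hg
    exact mF₁.1 (Finset.mem_filter.1 hg).1
  · intro g hg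
    exact mF₂.1 (Finset.mem_filter.1 hg).1
  · intro s hs t ht
    simp only [Finset.mem_filter, mF₁, mF₂] at hs ht
    rw [Finset.mem_sdiff, add_assoc, mem₁ hs.1, add_left_comm, mem₂ ht.1]
    exact ⟨hs.2, ht.2⟩
  · intro g hg
    exact mF₁.1 (Finset.mem_filter.1 hg).1
  · intro g hg
    exact mF₂.1 (Finset.mem_filter.1 hg).1
  · intro s hs t ht
    simp only [Finset.mem_filter, mF₁, mF₂, not_not] at hs ht
    rw [Finset.mem_sdiff, add_assoc, mem₁ hs.1, add_left_comm, mem₂ ht.1]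
    exact ⟨ht.2, hs.2⟩

/-- Kneser's union lemma. -/
theorem le_card_union_add_card_stab {C₁ C₂ : Finset G} (hC₁ : C₁.Nonempty) (hC₂ : C₂.Nonempty)
    {n : ℕ} (h₁ : n ≤ C₁.card + Nat.card (stab C₁)) (h₂ : n ≤ C₂.card + Nat.card (stab C₂)) :
    n ≤ (C₁ ∪ C₂).card + Nat.card (stab (C₁ ∪ C₂)) := by
  obtain h | ⟨x, hx⟩ := (C₂ \ C₁).eq_empty_or_nonempty
  · rwa [Finset.union_eq_left.2 (Finset.sdiff_eq_empty_iff_subset.1 h)]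
  obtain h | ⟨y, hy⟩ := (C₁ \ C₂).eq_empty_or_nonempty
  · rwa [Finset.union_eq_right.2 (Finset.sdiff_eq_empty_iff_subset.1 h)]
  have := finite_stab (hC₁.mono (Finset.subset_union_left (s₂ := C₂)))
  have hle : Nat.card ↥(stab C₁ ⊓ stab C₂) ≤ Nat.card (stab (C₁ ∪ C₂)) := by
    refine AddSubgroup.card_le_of_le fun g hg ↦ mem_stab.2 fun z hz ↦ ?_
    rw [Finset.mem_union] at hz ⊢
    exact hz.imp (mem_stab.1 hg.1 z) (mem_stab.1 hg.2 z)
  have k₁ := card_stab_le_of_mem_sdiff hC₁ hx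
  have k₂ := card_stab_le_of_mem_sdiff hC₂ hy
  rw [inf_comm] at k₂
  have c₁ := Finset.card_sdiff_add_card C₂ C₁
  have c₂ := Finset.card_sdiff_add_card C₁ C₂
  rw [Finset.union_comm] at c₁
  omega

/-- Repeated Dyson transforms reduce to a pair whose second set translates into the stabilizer of
the first. -/
theorem exists_subset_add_card_stab (A B : Finset G) {a b : G} (ha : a ∈ A) (hb : b ∈ B) :
    ∃ C ⊆ A + B, a + b ∈ C ∧ A.card + B.card ≤ C.card + Nat.card (stab C) := by
  induction hn : B.card using Nat.strong_induction_on generalizing A B with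
  | _ n ih =>
    subst hn
    by_cases h : ∀ e, e + b ∈ A → e +ᵥ B ⊆ A
    · refine ⟨b +ᵥ A, ?_, ?_, ?_⟩
      · intro z hz
        obtain ⟨y, hy, rfl⟩ := Finset.mem_vadd_finset.1 hz
        rw [vadd_eq_add, add_comm b]
        exact Finset.add_mem_add hy hb
      · rw [add_comm]
        exact Finset.vadd_mem_vadd_finset ha
      · have := finite_stab ⟨a, ha⟩
        rw [stab_vadd, Finset.card_vadd_finset, ← Nat.card_eq_finsetCard B]
        refine Nat.add_le_add_left (Nat.card_le_card_of_injective
          (fun y : B ↦ (⟨y - b, mem_stab.2 fun z hz ↦ ?_⟩ : stab A)) ?_) _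
        · have := h (z - b) (by simpa using hz) (Finset.vadd_mem_vadd_finset y.2)
          rwa [vadd_eq_add, sub_add_eq_add_sub, add_comm, add_sub_right_comm] at this
        · intro y y' h
          exact Subtype.ext (sub_left_injective (congrArg Subtype.val h))
    · push Not at h
      obtain ⟨e, he, hBe⟩ := h
      have hsub := Finset.addDysonETransform.subset e (A, B)
      have hcard := Finset.addDysonETransform.card e (A, B)
      simp only [Finset.addDysonETransform] at hsub hcard
      have hlt : (B ∩ (-e +ᵥ A)).card < B.card := by
        refine Finset.card_lt_card (Finset.ssubset_iff_subset_ne.2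
          ⟨Finset.inter_subset_left, fun hEq ↦ hBe fun z hz ↦ ?_⟩)
        obtain ⟨y, hy, rfl⟩ := Finset.mem_vadd_finset.1 hz
        simpa [Finset.mem_neg_vadd_finset_iff] using Finset.inter_eq_left.1 hEq hy
      have hmem : b ∈ B ∩ (-e +ᵥ A) :=
        Finset.mem_inter.2 ⟨hb, by simpa [Finset.mem_neg_vadd_finset_iff] using he⟩
      obtain ⟨C, hC, haC, hle⟩ :=
        ih _ hlt (A ∪ (e +ᵥ B)) (B ∩ (-e +ᵥ A)) (Finset.mem_union_left _ ha) hmem rfl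
      exact ⟨C, hC.trans hsub, haC, hcard ▸ hle⟩

/-- **Kneser's theorem**, without holes. -/
theorem card_add_card_le_card_add_add_card_stab {A B : Finset G} (hA : A.Nonempty)
    (hB : B.Nonempty) : A.card + B.card ≤ (A + B).card + Nat.card (stab (A + B)) := by
  have hex (c : G) (hc : c ∈ A + B) :
      ∃ C ⊆ A + B, c ∈ C ∧ A.card + B.card ≤ C.card + Nat.card (stab C) := by
    obtain ⟨a, ha, b, hb, rfl⟩ := Finset.mem_add.1 hc
    exact exists_subset_add_card_stab A B ha hb
  choose! f hf hcf hle using hex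
  have hsup : (A + B).sup' (hA.add hB) f = A + B :=
    le_antisymm (Finset.sup'_le _ _ hf) fun c hc ↦ Finset.le_sup' f hc (hcf c hc)
  have := Finset.sup'_induction (hA.add hB) f
    (p := fun C ↦ C.Nonempty ∧ A.card + B.card ≤ C.card + Nat.card (stab C))
    (fun C₁ h₁ C₂ h₂ ↦ ⟨h₁.1.mono Finset.subset_union_left,
      le_card_union_add_card_stab h₁.1 h₂.1 h₁.2 h₂.2⟩)
    (fun c hc ↦ ⟨⟨c, hcf c hc⟩, hle c hc⟩)
  rw [hsup] at this
  exact this.2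

theorem card_dvd_card_of_le_stab {H : AddSubgroup G} {S : Finset G} (hS : H ≤ stab S) :
    Nat.card H ∣ S.card := by
  have h : (S : Set G) + (H : Set G) = S := by
    refine Set.Subset.antisymm ?_ fun x hx ↦ ⟨x, hx, 0, H.zero_mem, add_zero x⟩
    rintro _ ⟨x, hx, g, hg, rfl⟩
    simpa [add_comm] using mem_stab.1 (hS hg) x hx
  have hcard := H.card_add_eq_card_addSubgroup_add_card_quotient (S : Set G)
  rw [h, SetLike.coe_sort_coe, Nat.card_eq_finsetCard] at hcard
  exact ⟨_, hcard⟩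

theorem kneser_with_holes (A B : Finset G) (hA : A.Nonempty) (hB : B.Nonempty)
    (H : AddSubgroup G) (hH : H = stab (A + B)) (ρ : ℤ)
    (hρ : ρ = ((Nat.card ↥((A : Set G) + (H : Set G)) : ℤ) - A.card)
        + ((Nat.card ↥((B : Set G) + (H : Set G)) : ℤ) - B.card)) :
    ((A.card : ℤ) + B.card - Nat.card H + ρ ≤ ((A + B).card : ℤ)) ∧
    (((A + B).card : ℤ) ≤ (A.card : ℤ) + B.card - 1 →
      (((A + B).card : ℤ) =
          (Nat.card ↥((A : Set G) + (H : Set G)) : ℤ)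
            + (Nat.card ↥((B : Set G) + (H : Set G)) : ℤ) - Nat.card H ∧
        ((A + B).card : ℤ) = (A.card : ℤ) + B.card - Nat.card H + ρ)) := by
  have hne := hA.add hB
  have : Finite H := hH ▸ finite_stab hne
  have hadd (X : Finset G) : ∃ X' : Finset G, (X' : Set G) = (X : Set G) + (H : Set G) :=
    ((X.finite_toSet).add (Set.toFinite (H : Set G))).exists_finset_coe
  obtain ⟨A', hA'⟩ := hadd A
  obtain ⟨B', hB'⟩ := hadd B
  have hle (X X' : Finset G) (hX' : (X' : Set G) = (X : Set G) + (H : Set G)) : H ≤ stab X' := by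
    refine fun g hg ↦ mem_stab.2 fun x hx ↦ ?_
    rw [← Finset.mem_coe, hX'] at hx ⊢
    obtain ⟨y, hy, k, hk, rfl⟩ := hx
    exact ⟨y, hy, g + k, H.add_mem hg hk, add_left_comm y g k⟩
  have hsub (X X' : Finset G) (hX' : (X' : Set G) = (X : Set G) + (H : Set G)) : X ⊆ X' := by
    rw [← Finset.coe_subset, hX']
    exact fun x hx ↦ ⟨x, hx, 0, H.zero_mem, add_zero x⟩
  have hsum : A' + B' = A + B := by
    refine (Finset.add_subset_add (hsub A A' hA') (hsub B B' hB')).antisymm' ?_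
    intro z hz
    obtain ⟨x, hx, y, hy, rfl⟩ := Finset.mem_add.1 hz
    rw [← Finset.mem_coe, hA'] at hx
    rw [← Finset.mem_coe, hB'] at hy
    obtain ⟨a, ha, g, hg, rfl⟩ := hx
    obtain ⟨b, hb, k, hk, rfl⟩ := hy
    have := mem_stab.1 (hH ▸ H.add_mem hg hk : g + k ∈ stab (A + B)) _ (Finset.add_mem_add ha hb)
    rwa [add_add_add_comm, add_comm g, add_comm k] at this
  have hkneser := card_add_card_le_card_add_add_card_stab (hA.mono (hsub A A' hA'))
    (hB.mono (hsub B B' hB'))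
  rw [hsum, ← hH] at hkneser
  have hAcard := Finset.card_le_card (hsub A A' hA')
  have hBcard := Finset.card_le_card (hsub B B' hB')
  obtain ⟨u, hu⟩ := card_dvd_card_of_le_stab (hle A A' hA')
  obtain ⟨v, hv⟩ := card_dvd_card_of_le_stab (hle B B' hB')
  obtain ⟨w, hw⟩ := card_dvd_card_of_le_stab hH.le
  have hupper (h : (A + B).card < A.card + B.card) :
      (A + B).card + Nat.card H ≤ A'.card + B'.card := by
    have hlt : Nat.card H * w < Nat.card H * (u + v) := by
      rw [mul_add]
      omega
    have := Nat.mul_le_mul_left (Nat.card H) (Nat.succ_le_of_lt (Nat.lt_of_mul_lt_mul_left hlt))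
    rw [Nat.succ_eq_add_one, mul_add, mul_add, mul_one] at this
    omega
  simp only [← hA', ← hB', SetLike.coe_sort_coe, Nat.card_eq_finsetCard] at hρ ⊢
  omega
end

section
/- Let G be an abelian group, let A, B ⊆ G be finite and nonempty, and let x ∈ A − B. Define the Dyson transform B(x) = (x + B) ∩ A and A(x) = (x + B) ∪ A. Then |A(x)| + |B(x)| = |A| + |B|, and for every i ≥ 1, A(x) +_i B(x) ⊆ x + (A +_i B). -/
open scoped Pointwise

variable {G : Type*} [AddCommGroup G] [DecidableEq G]

theorem mem_vadd_finset_iff_sub_mem {x y : G} {S : Finset G} : y ∈ x +ᵥ S ↔ y - x ∈ S := by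
  rw [← Finset.neg_vadd_mem_iff, vadd_eq_add, neg_add_eq_sub]

theorem mem_repSum {A B : Finset G} {i : ℕ} (hi : 1 ≤ i) {g : G} :
    g ∈ repSum A B i ↔ i ≤ rep A B g := by
  refine ⟨fun h => (Finset.mem_filter.1 h).2, fun h => Finset.mem_filter.2 ⟨?_, h⟩⟩
  obtain ⟨p, hp⟩ := Finset.card_pos.1 (lt_of_lt_of_le hi h)
  simp only [Finset.mem_filter, Finset.mem_product] at hp
  exact hp.2 ▸ Finset.add_mem_add hp.1.1 hp.1.2

/-- The union and intersection of two sets represent each element at most as often as the sets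
themselves do: swap the coordinates of `(p, q)` whenever `p ∉ A`. -/
theorem rep_union_inter_le (A C : Finset G) (g : G) :
    rep (C ∪ A) (C ∩ A) g ≤ rep A C g := by
  refine Finset.card_le_card_of_injOn (fun p => if p.1 ∈ A then p else p.swap) ?_ ?_
  · rintro ⟨p, q⟩ h
    simp only [Finset.coe_filter, Finset.mem_product, Finset.mem_union, Finset.mem_inter,
      Set.mem_ofPred_eq] at h ⊢
    split_ifs with hp
    · exact ⟨⟨hp, h.1.2.1⟩, h.2⟩
    · exact ⟨⟨h.1.2.2, h.1.1.resolve_right hp⟩, (add_comm q p).trans h.2⟩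
  · rintro ⟨p, q⟩ h ⟨p', q'⟩ h' e
    simp only [Finset.coe_filter, Finset.mem_product, Finset.mem_union, Finset.mem_inter,
      Set.mem_ofPred_eq] at h h'
    dsimp only at e
    split_ifs at e <;> simp only [Prod.swap, Prod.mk.injEq] at e ⊢ <;> grind

theorem rep_vadd_right (A B : Finset G) (x g : G) : rep A (x +ᵥ B) g = rep A B (g - x) := by
  refine Finset.card_bij' (fun p _ => (p.1, p.2 - x)) (fun p _ => (p.1, p.2 + x)) ?_ ?_ ?_ ?_
  · rintro ⟨p, q⟩ h
    simp only [Finset.mem_filter, Finset.mem_product, mem_vadd_finset_iff_sub_mem] at h ⊢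
    exact ⟨h.1, by rw [← h.2, add_sub_assoc]⟩
  · rintro ⟨p, q⟩ h
    simp only [Finset.mem_filter, Finset.mem_product, mem_vadd_finset_iff_sub_mem,
      add_sub_cancel_right] at h ⊢
    exact ⟨h.1, by rw [← add_assoc, h.2, sub_add_cancel]⟩
  · simp
  · simp

theorem dyson_transform (A B : Finset G) (hA : A.Nonempty) (hB : B.Nonempty)
    (x : G) (hx : x ∈ A - B) :
    (((x +ᵥ B) ∪ A).card + ((x +ᵥ B) ∩ A).card = A.card + B.card) ∧
    ∀ i : ℕ, 1 ≤ i →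
      repSum ((x +ᵥ B) ∪ A) ((x +ᵥ B) ∩ A) i ⊆ x +ᵥ repSum A B i := by
  refine ⟨?_, fun i hi g hg => ?_⟩
  · rw [Finset.card_union_add_card_inter, Finset.card_vadd_finset, add_comm]
  · rw [mem_vadd_finset_iff_sub_mem, mem_repSum hi, ← rep_vadd_right]
    exact ((mem_repSum hi).1 hg).trans (rep_union_inter_le A (x +ᵥ B) g)
end
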